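/- arXiv:2105.00299 — 2 statements merged into one kernel-verified Lean document; each statement's English description precedes it below -/
import Mathlib

section
/- Suppose a cactus graph G is revealed in an order v_1,…,v_n in which every prefix {v_1,…,v_i} induces a connected subgraph, and the algorithm 2-DOMINATE is run on this input. Then every vertex v_i with degree at least 4 in G is selected by 2-DOMINATE. -/
open SimpleGraph

attribute [local instance] Classical.propDecidable

/-- `D` is a dominating set of `G`: every vertex is in `D` or adjacent to a member of `D`. -/
def IsDomSet {V : Type*} (G : SimpleGraph V) (D : Set V) : Prop :=
  ∀ v : V, v ∈ D ∨ ∃ u ∈ D, G.Adj u v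

/-- The domination number `γ(G)`: the minimum size of a dominating set. -/
noncomputable def domNum {V : Type*} [Fintype V] (G : SimpleGraph V) : ℕ :=
  sInf {k | ∃ D : Finset V, IsDomSet G ↑D ∧ D.card = k}

/-- Every prefix `{v_0, …, v_i}` of the revelation order induces a connected subgraph.
(The input graph is presented on `Fin n`, vertex `i` being revealed at time `i`.) -/
def PrefixConnected {n : ℕ} (G : SimpleGraph (Fin n)) : Prop :=
  ∀ i : Fin n, (SimpleGraph.induce {v : Fin n | v ≤ i} G).Connected

/-- Closed neighborhood of a finite set of vertices. -/
noncomputable def closedN {n : ℕ} (G : SimpleGraph (Fin n)) (A : Finset (Fin n)) :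
    Finset (Fin n) :=
  Finset.univ.filter fun v => v ∈ A ∨ ∃ u ∈ A, G.Adj u v

/-- `R_i`: the vertices revealed by time `i`. -/
noncomputable def Rset (n : ℕ) (i : ℕ) : Finset (Fin n) :=
  Finset.univ.filter fun v => (v : ℕ) ≤ i

/-- `U_i`: visible vertices undominated just before the decision at time `i`,
given the set `Sprev` of previously selected vertices. -/
noncomputable def Uset {n : ℕ} (G : SimpleGraph (Fin n)) (i : ℕ) (Sprev : Finset (Fin n)) :
    Finset (Fin n) :=
  closedN G (Rset n i) \ closedN G Sprev

/-- The open neighborhood of a vertex, as a finset. -/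
noncomputable def nbrs {n : ℕ} (G : SimpleGraph (Fin n)) (v : Fin n) : Finset (Fin n) :=
  Finset.univ.filter fun w => G.Adj v w

/-- The degree of a vertex. -/
noncomputable def deg {n : ℕ} (G : SimpleGraph (Fin n)) (v : Fin n) : ℕ := (nbrs G v).card

/-- `vj` saves `vm`: `vj` is the last vertex of `N[vm]` in the revelation order and
`N[vm] \ {vj}` contains no previously selected vertex. -/
def Saves {n : ℕ} (G : SimpleGraph (Fin n)) (Sprev : Finset (Fin n)) (vj vm : Fin n) : Prop :=
  (vj = vm ∨ G.Adj vm vj) ∧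
  (∀ w : Fin n, (w = vm ∨ G.Adj vm w) → (w : ℕ) ≤ (vj : ℕ)) ∧
  (∀ w : Fin n, (w = vm ∨ G.Adj vm w) → w ≠ vj → w ∉ Sprev)

/-- Decision of `k`-DOMINATE at vertex `vi` with previously selected set `Sprev`:
select iff `vi` has at least `k` undominated neighbors, or `vi` saves some vertex. -/
def kDomDecision {n : ℕ} (G : SimpleGraph (Fin n)) (k : ℕ) (vi : Fin n)
    (Sprev : Finset (Fin n)) : Prop :=
  k ≤ (nbrs G vi ∩ Uset G (vi : ℕ) Sprev).card ∨ ∃ vm : Fin n, Saves G Sprev vi vm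

/-- The set of vertices selected by `k`-DOMINATE after the first `i` decisions. -/
noncomputable def kDomStep {n : ℕ} (G : SimpleGraph (Fin n)) (k : ℕ) : ℕ → Finset (Fin n)
  | 0 => ∅
  | i + 1 =>
    kDomStep G k i ∪
      if h : i < n then
        if kDomDecision G k ⟨i, h⟩ (kDomStep G k i) then {⟨i, h⟩} else ∅
      else ∅

/-- The output of the online algorithm `k`-DOMINATE. -/
noncomputable def kDomOutput {n : ℕ} (G : SimpleGraph (Fin n)) (k : ℕ) : Finset (Fin n) :=
  kDomStep G k n

/-- A cactus graph: connected, and every edge lies on at most one cycle (any two cycles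
through a common edge have the same edge set). -/
def IsCactus {V : Type*} (G : SimpleGraph V) : Prop :=
  G.Connected ∧
    ∀ ⦃u v : V⦄ (c₁ : G.Walk u u) (c₂ : G.Walk v v), c₁.IsCycle → c₂.IsCycle →
      ∀ e ∈ c₁.edges, e ∈ c₂.edges → {e' | e' ∈ c₁.edges} = {e' | e' ∈ c₂.edges}

lemma kDomStep_lt {n : ℕ} (G : SimpleGraph (Fin n)) (k : ℕ) (i : ℕ) :
    ∀ u ∈ kDomStep G k i, (u : ℕ) < i := by
  induction i with
  | zero => intro u hu; simp [kDomStep] at hu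
  | succ i ih =>
    intro u hu
    rw [kDomStep, Finset.mem_union] at hu
    rcases hu with hu | hu
    · have := ih u hu
      omega
    · split_ifs at hu
      · rw [Finset.mem_singleton] at hu
        subst hu
        simp
      · simp at hu
      · simp at hu

lemma kDomStep_mono {n : ℕ} (G : SimpleGraph (Fin n)) (k : ℕ) {i j : ℕ} (h : i ≤ j) :
    kDomStep G k i ⊆ kDomStep G k j := by
  induction h with
  | refl => exact fun _ h => h
  | step _ ih =>
    intro u hu
    rw [kDomStep]
    exact Finset.mem_union_left _ (ih hu)

lemma mem_output_of_decision {n : ℕ} (G : SimpleGraph (Fin n)) (k : ℕ) (v : Fin n)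
    (h : kDomDecision G k v (kDomStep G k v)) : v ∈ kDomOutput G k := by
  apply kDomStep_mono G k (Nat.succ_le_of_lt v.2)
  rw [kDomStep]
  apply Finset.mem_union_right
  rw [dif_pos v.2, if_pos h]
  simp

lemma prefix_walk {n : ℕ} (G : SimpleGraph (Fin n)) (hpc : PrefixConnected G) (v x y : Fin n)
    (hx : x < v) (hy : y < v) : ∃ p : G.Walk x y, v ∉ p.support := by
  have hpos : 0 < (v : ℕ) := by
    have : (x : ℕ) < v := hx
    omega
  let i : Fin n := ⟨(v : ℕ) - 1, by omega⟩
  have hi : ∀ z : Fin n, z < v ↔ z ≤ i := by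
    intro z
    simp only [Fin.lt_def, Fin.le_def, i]
    omega
  obtain ⟨p⟩ := (hpc i).preconnected ⟨x, (hi x).1 hx⟩ ⟨y, (hi y).1 hy⟩
  refine ⟨p.map (SimpleGraph.Embedding.induce _).toHom, ?_⟩
  intro hv
  have hv' := (SimpleGraph.Walk.support_map (SimpleGraph.Embedding.induce _).toHom p) ▸ hv
  obtain ⟨w, _, hw⟩ := List.mem_map.1 hv'
  have h1 : (w : Fin n) ≤ i := w.2
  have h2 : (w : Fin n) = v := hw
  rw [h2, ← hi] at h1
  exact lt_irrefl _ h1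

/-- A neighbor of `v` dominated by vertices before `v` has a `v`-avoiding walk into the prefix. -/
lemma dom_walk {n : ℕ} (G : SimpleGraph (Fin n)) (hpc : PrefixConnected G) (v a b : Fin n)
    (hav : a ≠ v) (hbv : b ≠ v)
    (ha : a < v ∨ ∃ u, u < v ∧ G.Adj u a) (hb : b < v ∨ ∃ u, u < v ∧ G.Adj u b) :
    ∃ p : G.Walk a b, v ∉ p.support := by
  have key : ∀ c, c ≠ v → (c < v ∨ ∃ u, u < v ∧ G.Adj u c) →
      ∃ x, x < v ∧ ∃ p : G.Walk x c, v ∉ p.support := by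
    rintro c hcv (hc | ⟨u, hu, huc⟩)
    · exact ⟨c, hc, SimpleGraph.Walk.nil, by simpa using hcv.symm⟩
    · exact ⟨u, hu, SimpleGraph.Walk.cons huc SimpleGraph.Walk.nil,
        by simpa using ⟨hu.ne', hcv.symm⟩⟩
  obtain ⟨x, hx, p, hp⟩ := key a hav ha
  obtain ⟨y, hy, q, hq⟩ := key b hbv hb
  obtain ⟨r, hr⟩ := prefix_walk G hpc v x y hx hy
  refine ⟨p.reverse.append (r.append q), ?_⟩
  simp only [SimpleGraph.Walk.mem_support_append_iff, SimpleGraph.Walk.support_reverse,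
    List.mem_reverse]
  tauto

lemma exists_cycle {n : ℕ} (G : SimpleGraph (Fin n)) (v a b : Fin n) (hab : a ≠ b)
    (hva : G.Adj v a) (hvb : G.Adj v b) (h : ∃ p : G.Walk a b, v ∉ p.support) :
    ∃ c : G.Walk v v, c.IsCycle ∧ ∀ x, s(v, x) ∈ c.edges ↔ x = a ∨ x = b := by
  obtain ⟨p, hp⟩ := h
  have hq : v ∉ p.bypass.support := fun h => hp (p.support_bypass_subset_support h)
  have hqp : p.bypass.IsPath := p.bypass_isPath
  generalize p.bypass = q at hq hqp
  have hqe : ∀ x, s(v, x) ∉ q.edges := fun x hx =>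
    hq (q.fst_mem_support_of_mem_edges hx)
  have hne : a ≠ v := hva.ne'
  refine ⟨SimpleGraph.Walk.cons hva (q.concat hvb.symm), ?_, ?_⟩
  · apply SimpleGraph.Path.cons_isCycle ⟨q.concat hvb.symm, hqp.concat hq hvb.symm⟩ hva
    simp only [SimpleGraph.Walk.edges_concat, List.concat_eq_append, List.mem_append,
      List.mem_singleton, not_or]
    refine ⟨hqe a, ?_⟩
    simp only [Sym2.eq_iff]
    have := hvb.ne
    tauto
  · intro x
    have h1 := hva.ne
    have h2 := hvb.ne
    have h3 := hqe x
    simp only [SimpleGraph.Walk.edges_cons, SimpleGraph.Walk.edges_concat,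
      List.concat_eq_append, List.mem_append, List.mem_cons, List.not_mem_nil, Sym2.eq_iff]
    grind

/-- When 2-DOMINATE runs on a cactus graph revealed with connected
prefixes, every vertex of degree at least 4 is selected. -/
theorem two_dominate_selects_deg_four {n : ℕ} (G : SimpleGraph (Fin n)) (hG : IsCactus G)
    (hpc : PrefixConnected G) (v : Fin n) (hdeg : 4 ≤ deg G v) :
    v ∈ kDomOutput G 2 := by
  apply mem_output_of_decision
  left
  by_contra hlt
  set S := kDomStep G 2 v with hS
  have hsub : nbrs G v \ closedN G S ⊆ nbrs G v ∩ Uset G (v : ℕ) S := by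
    intro w hw
    simp only [Finset.mem_sdiff, nbrs, Finset.mem_filter, Finset.mem_univ, true_and] at hw
    simp only [Finset.mem_inter, Uset, Finset.mem_sdiff, nbrs, Finset.mem_filter,
      Finset.mem_univ, true_and]
    refine ⟨hw.1, ?_, hw.2⟩
    simp only [closedN, Rset, Finset.mem_filter, Finset.mem_univ, true_and]
    exact Or.inr ⟨v, le_rfl, hw.1⟩
  have hc1 := Finset.card_le_card hsub
  have hc2 := Finset.card_sdiff_add_card_inter (nbrs G v) (closedN G S)
  have hc3 : 2 < (nbrs G v ∩ closedN G S).card := by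
    unfold deg at hdeg
    omega
  obtain ⟨a, b, c, ha, hb, hc, hab, hac, hbc⟩ := Finset.two_lt_card_iff.1 hc3
  have hmem : ∀ w, w ∈ nbrs G v ∩ closedN G S →
      G.Adj v w ∧ (w < v ∨ ∃ u, u < v ∧ G.Adj u w) := by
    intro w hw
    simp only [Finset.mem_inter, nbrs, closedN, Finset.mem_filter, Finset.mem_univ,
      true_and] at hw
    refine ⟨hw.1, ?_⟩
    rcases hw.2 with h | ⟨u, hu, huw⟩
    · exact Or.inl (kDomStep_lt G 2 v w h)
    · exact Or.inr ⟨u, kDomStep_lt G 2 v u hu, huw⟩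
  obtain ⟨ha1, ha2⟩ := hmem a ha
  obtain ⟨hb1, hb2⟩ := hmem b hb
  obtain ⟨hc1', hc2'⟩ := hmem c hc
  obtain ⟨c1, hcy1, he1⟩ := exists_cycle G v a b hab ha1 hb1
    (dom_walk G hpc v a b ha1.ne' hb1.ne' ha2 hb2)
  obtain ⟨c2, hcy2, he2⟩ := exists_cycle G v a c hac ha1 hc1'
    (dom_walk G hpc v a c ha1.ne' hc1'.ne' ha2 hc2')
  have heq := hG.2 c1 c2 hcy1 hcy2 s(v, a) ((he1 a).2 (Or.inl rfl)) ((he2 a).2 (Or.inl rfl))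
  have hb3 : s(v, b) ∈ {e' | e' ∈ c2.edges} := by
    rw [← heq]
    exact (he1 b).2 (Or.inr rfl)
  rcases (he2 b).1 hb3 with h | h
  · exact hab h.symm
  · exact hbc h
end

section
/- Let Δ ≥ 2 be an integer. For every connected finite simple graph G of maximum degree at most Δ and every revelation order v_1,…,v_n of its vertices in which every prefix induces a connected subgraph, the set S of vertices selected by the algorithm ⌈√Δ⌉-DOMINATE is a dominating set of G and satisfies |S| ≤ 3·√Δ·γ(G). -/
open SimpleGraph

attribute [local instance] Classical.propDecidable

theorem mem_kDomStep {n : ℕ} (G : SimpleGraph (Fin n)) (k i : ℕ) (v : Fin n) :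
    v ∈ kDomStep G k i ↔ (v : ℕ) < i ∧ kDomDecision G k v (kDomStep G k v) := by
  induction i with
  | zero => simp [kDomStep]
  | succ i ih =>
    rw [kDomStep, Finset.mem_union, ih]
    constructor
    · rintro (h | h)
      · exact ⟨by omega, h.2⟩
      · split_ifs at h with h1 h2
        · rw [Finset.mem_singleton] at h
          subst h
          exact ⟨by simp, h2⟩
        · simp at h
        · simp at h
    · rintro ⟨h1, h2⟩
      by_cases hv : (v : ℕ) < i
      · exact Or.inl ⟨hv, h2⟩
      · right
        have hvi : (v : ℕ) = i := by omega
        subst hvi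
        simp [h2]

theorem mem_out {n : ℕ} (G : SimpleGraph (Fin n)) (k : ℕ) (v : Fin n) :
    v ∈ kDomOutput G k ↔ kDomDecision G k v (kDomStep G k v) := by
  rw [kDomOutput, mem_kDomStep]
  simp

theorem mem_step_of_lt {n : ℕ} (G : SimpleGraph (Fin n)) (k i : ℕ) (v : Fin n) :
    v ∈ kDomStep G k i ↔ (v : ℕ) < i ∧ v ∈ kDomOutput G k := by
  rw [mem_out, mem_kDomStep]

theorem out_dom {n : ℕ} (G : SimpleGraph (Fin n)) (k : ℕ) :
    IsDomSet G ↑(kDomOutput G k) := by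
  intro v
  by_contra hcon
  push Not at hcon
  obtain ⟨h1, h2⟩ := hcon
  have hno : ∀ w, (w = v ∨ G.Adj v w) → w ∉ kDomOutput G k := by
    rintro w (rfl | hw) hm
    · exact h1 hm
    · exact h2 w hm hw.symm
  obtain ⟨j, hj, hmax⟩ := Finset.exists_max_image
    (Finset.univ.filter fun w => w = v ∨ G.Adj v w) (fun w => (w : ℕ)) ⟨v, by simp⟩
  rw [Finset.mem_filter] at hj
  apply hno j hj.2
  rw [mem_out]
  refine Or.inr ⟨v, hj.2, fun w hw => hmax w (by simpa using hw), fun w hw _ hm => ?_⟩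
  exact hno w hw ((mem_step_of_lt _ _ _ _).1 hm).2

theorem card_le_dom {n : ℕ} (G : SimpleGraph (Fin n)) (Δ : ℕ) (hdeg : ∀ v, deg G v ≤ Δ)
    (D : Finset (Fin n)) (hD : IsDomSet G ↑D) : n ≤ (Δ + 1) * D.card := by
  have h : (Finset.univ : Finset (Fin n)) ⊆ D.biUnion fun d => insert d (nbrs G d) := by
    intro v _
    rw [Finset.mem_biUnion]
    rcases hD v with h | ⟨u, hu, h⟩
    · exact ⟨v, h, Finset.mem_insert_self _ _⟩
    · exact ⟨u, hu, Finset.mem_insert_of_mem (by simp [nbrs, h])⟩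
  have h2 := Finset.card_le_card h
  rw [Finset.card_univ, Fintype.card_fin] at h2
  have h3 := Finset.card_biUnion_le_card_mul D (fun d => insert d (nbrs G d)) (Δ + 1)
    (fun d _ => (Finset.card_insert_le _ _).trans (Nat.succ_le_succ (hdeg d)))
  rw [mul_comm]
  exact h2.trans h3

theorem card_A {n : ℕ} (G : SimpleGraph (Fin n)) (k : ℕ) :
    ((kDomOutput G k).filter fun v =>
      k ≤ (nbrs G v ∩ Uset G (v : ℕ) (kDomStep G k v)).card).card * k ≤ n := by
  set A := (kDomOutput G k).filter fun v =>
      k ≤ (nbrs G v ∩ Uset G (v : ℕ) (kDomStep G k v)).card with hA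
  have key : ∀ a ∈ A, ∀ b : Fin n, a < b → ∀ w, w ∈ nbrs G a →
      w ∈ Uset G (b : ℕ) (kDomStep G k b) → False := by
    intro a ha b hab w hw hU
    rw [hA, Finset.mem_filter] at ha
    rw [Uset, Finset.mem_sdiff] at hU
    apply hU.2
    rw [closedN, Finset.mem_filter]
    refine ⟨Finset.mem_univ _, Or.inr ⟨a, ?_, by simpa [nbrs] using hw⟩⟩
    exact (mem_step_of_lt _ _ _ _).2 ⟨hab, ha.1⟩
  have hdis : ((A : Set (Fin n))).PairwiseDisjoint
      (fun v => nbrs G v ∩ Uset G (v : ℕ) (kDomStep G k v)) := by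
    intro a ha b hb hab
    rw [Function.onFun, Finset.disjoint_left]
    intro w hwa hwb
    rw [Finset.mem_inter] at hwa hwb
    rcases lt_or_gt_of_ne hab with h | h
    · exact key a ha b h w hwa.1 hwb.2
    · exact key b hb a h w hwb.1 hwa.2
  have h1 := Finset.card_biUnion hdis
  have h2 := Finset.card_nsmul_le_sum A
    (fun v => (nbrs G v ∩ Uset G (v : ℕ) (kDomStep G k v)).card) k
    (fun a ha => by rw [hA, Finset.mem_filter] at ha; exact ha.2)
  rw [← h1, smul_eq_mul] at h2
  refine h2.trans ((Finset.card_le_univ _).trans ?_)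
  simp

theorem card_B {n : ℕ} (G : SimpleGraph (Fin n)) (k : ℕ) (hk : 1 ≤ k)
    (D : Finset (Fin n)) (hD : IsDomSet G ↑D) :
    ((kDomOutput G k).filter fun v =>
      ¬ k ≤ (nbrs G v ∩ Uset G (v : ℕ) (kDomStep G k v)).card).card ≤ k * D.card := by
  set B := (kDomOutput G k).filter fun v =>
      ¬ k ≤ (nbrs G v ∩ Uset G (v : ℕ) (kDomStep G k v)).card with hB
  have hs : ∀ b : Fin n, ∃ m : Fin n, b ∈ B → Saves G (kDomStep G k b) b m := by
    intro b
    by_cases hb : b ∈ B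
    · have hb' := hb
      rw [hB, Finset.mem_filter, mem_out] at hb'
      rcases hb'.1 with h | ⟨m, hm⟩
      · exact absurd h hb'.2
      · exact ⟨m, fun _ => hm⟩
    · exact ⟨b, fun h => absurd h hb⟩
  choose m hm using hs
  have hd : ∀ v : Fin n, ∃ d ∈ D, d = v ∨ G.Adj v d := by
    intro v
    rcases hD v with h | ⟨u, hu, h⟩
    · exact ⟨v, h, Or.inl rfl⟩
    · exact ⟨u, hu, Or.inr h.symm⟩
  choose d hdD hdN using hd
  refine Finset.card_le_mul_card_image_of_maps_to (f := fun b => d (m b))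
    (fun b _ => hdD _) k ?_
  intro e _
  have hF : ∀ b ∈ B.filter (fun b => d (m b) = e), Saves G (kDomStep G k b) b (m b) ∧
      (e = m b ∨ G.Adj (m b) e) ∧ (e : ℕ) ≤ b := by
    intro b hb
    rw [Finset.mem_filter] at hb
    have h1 := hm b hb.1
    have h2 := hdN (m b)
    rw [hb.2] at h2
    exact ⟨h1, h2, h1.2.1 e h2⟩
  by_cases he : e ∈ kDomOutput G k
  · refine le_trans (Finset.card_le_one.2 ?_) hk
    have h1 : ∀ b ∈ B.filter (fun b => d (m b) = e), e = b := by
      intro b hb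
      obtain ⟨hS, hN, hle⟩ := hF b hb
      by_contra hne
      refine hS.2.2 e hN hne ((mem_step_of_lt _ _ _ _).2 ⟨?_, he⟩)
      have : (e : ℕ) ≠ b := fun h => hne (Fin.ext h)
      omega
    intro a ha b hb
    rw [← h1 a ha, ← h1 b hb]
  · have hlt : (nbrs G e ∩ Uset G (e : ℕ) (kDomStep G k e)).card < k := by
      by_contra hcon
      exact he ((mem_out _ _ _).2 (Or.inl (not_lt.1 hcon)))
    have hle : (B.filter (fun b => d (m b) = e)).card ≤
        (insert e (nbrs G e ∩ Uset G (e : ℕ) (kDomStep G k e))).card := by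
      refine Finset.card_le_card_of_injOn m ?_ ?_
      · intro b hb
        obtain ⟨hS, hN, hle⟩ := hF b hb
        rw [Finset.mem_coe, Finset.mem_insert]
        rcases hN with hN | hN
        · exact Or.inl hN.symm
        · right
          have hno : ∀ w, (w = m b ∨ G.Adj (m b) w) → w ∉ kDomStep G k e := by
            intro w hw hmem
            have h3 := (mem_step_of_lt _ _ _ _).1 hmem
            refine hS.2.2 w hw ?_ ((mem_step_of_lt _ _ _ _).2 ⟨by omega, h3.2⟩)
            rintro rfl
            omega
          rw [Finset.mem_inter, Uset, Finset.mem_sdiff]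
          refine ⟨by simp [nbrs, hN.symm], ?_, ?_⟩
          · rw [closedN, Finset.mem_filter]
            exact ⟨Finset.mem_univ _, Or.inr ⟨e, by simp [Rset], hN.symm⟩⟩
          · rw [closedN, Finset.mem_filter]
            rintro ⟨_, h | ⟨u, hu, h⟩⟩
            · exact hno _ (Or.inl rfl) h
            · exact hno _ (Or.inr h.symm) hu
      · intro a ha b hb hab
        obtain ⟨hSa, -, -⟩ := hF a ha
        obtain ⟨hSb, -, -⟩ := hF b hb
        rw [hab] at hSa
        exact Fin.ext (le_antisymm (hSb.2.1 a hSa.1) (hSa.2.1 b hSb.1))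
    have := Finset.card_insert_le e (nbrs G e ∩ Uset G (e : ℕ) (kDomStep G k e))
    omega

theorem arith_bound (Δ k : ℕ) (hΔ : 2 ≤ Δ) (hk : k = ⌈Real.sqrt Δ⌉₊) :
    (k : ℝ) * k + (Δ + 1) ≤ 3 * Real.sqrt Δ * k := by
  have h0 : 0 ≤ Real.sqrt Δ := Real.sqrt_nonneg _
  have hsq : Real.sqrt Δ * Real.sqrt Δ = Δ := Real.mul_self_sqrt (by positivity)
  have h1 : Real.sqrt Δ ≤ k := by rw [hk]; exact Nat.le_ceil _
  have h2 : (k : ℝ) < Real.sqrt Δ + 1 := by rw [hk]; exact Nat.ceil_lt_add_one h0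
  set s := Real.sqrt Δ
  rcases Nat.lt_or_ge Δ 3 with h | h
  · have hD : Δ = 2 := by omega
    have hs2 : s * s = 2 := by rw [hsq, hD]; norm_num
    have hs : (1.4 : ℝ) < s := by nlinarith
    have hs' : s < 1.5 := by nlinarith
    have hk2 : k = 2 := by
      have a : (1 : ℝ) < k := by linarith
      have b : (k : ℝ) < 3 := by linarith
      have a' : 1 < k := by exact_mod_cast a
      have b' : k < 3 := by exact_mod_cast b
      omega
    rw [hk2, hD]
    push_cast
    linarith
  · have hD : (3 : ℝ) ≤ Δ := by exact_mod_cast h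
    have hs : (1.7 : ℝ) < s := by nlinarith
    rw [← hsq]
    nlinarith [mul_nonneg (sub_nonneg.2 h1) (sub_nonneg.2 h2.le)]

/-- On every connected graph of maximum degree at most `Δ` revealed with
connected prefixes, `⌈√Δ⌉`-DOMINATE outputs a dominating set of size at most
`3·√Δ·γ(G)`. -/
theorem sqrt_dominate_bounded_degree (Δ : ℕ) (hΔ : 2 ≤ Δ) {n : ℕ}
    (G : SimpleGraph (Fin n)) (hconn : G.Connected) (hdeg : ∀ v, deg G v ≤ Δ)
    (hpc : PrefixConnected G) :
    IsDomSet G ↑(kDomOutput G ⌈Real.sqrt Δ⌉₊) ∧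
      ((kDomOutput G ⌈Real.sqrt Δ⌉₊).card : ℝ) ≤ 3 * Real.sqrt Δ * (domNum G : ℝ) := by
  set k := ⌈Real.sqrt Δ⌉₊ with hk
  refine ⟨out_dom G k, ?_⟩
  have hk1 : 1 ≤ k := by
    rw [hk, Nat.one_le_ceil_iff]
    exact Real.sqrt_pos.2 (by positivity)
  obtain ⟨D, hD, hDc⟩ : ∃ D : Finset (Fin n), IsDomSet G ↑D ∧ D.card = domNum G :=
    Nat.sInf_mem (s := {k | ∃ D : Finset (Fin n), IsDomSet G ↑D ∧ D.card = k})
      ⟨_, _, out_dom G k, rfl⟩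
  rw [← hDc]
  have hA := (card_A G k).trans (card_le_dom G Δ hdeg D hD)
  have hB := card_B G k hk1 D hD
  have hS := Finset.card_filter_add_card_filter_not (s := kDomOutput G k)
    (fun v => k ≤ (nbrs G v ∩ Uset G (v : ℕ) (kDomStep G k v)).card)
  have hN : (kDomOutput G k).card * k ≤ (k * k + (Δ + 1)) * D.card := by
    rw [← hS]
    nlinarith [Nat.mul_le_mul_right k hB]
  have hR : ((kDomOutput G k).card : ℝ) * k ≤ (k * k + (Δ + 1)) * D.card := by
    exact_mod_cast hN
  have har := mul_le_mul_of_nonneg_right (arith_bound Δ k hΔ hk) (Nat.cast_nonneg (α := ℝ) D.card)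
  have hkp : (0 : ℝ) < k := by exact_mod_cast hk1
  refine le_of_mul_le_mul_right ?_ hkp
  linarith
end
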